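/- arXiv:2206.03381 — 2 statements merged into one kernel-verified Lean document; each statement's English description precedes it below -/
import Mathlib

section
/- Correctness of the observation-projection system (key lemma in the proof of Theorem 1): Let T = (S, S_0, ρ) be an explicit transition system and O ⊆ S an observation set. Define T_O = (O, S_0', ρ') where S_0' is the set of all s ∈ O such that there exist n ≥ 0 and states s_0, …, s_n with s_0 ∈ S_0, s_n = s, (s_i, s_{i+1}) ∈ ρ for all 0 ≤ i ≤ n−1, and s_i ∉ O for all 0 ≤ i ≤ n−1; and ρ' is the set of all pairs (s, s') ∈ O × O such that there exist n ≥ 1 and states s_0, …, s_n with s_0 = s, s_n = s', (s_i, s_{i+1}) ∈ ρ for all 0 ≤ i ≤ n−1, and s_i ∉ O for all 1 ≤ i ≤ n−1. Then Traces(T_O) = { t|O : t ∈ Traces(T) and O is a valid observation on t }. -/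
/-- A trace of the explicit transition system `(S₀, ρ)`. -/
def IsTrace {S : Type*} (S0 : Set S) (ρ : Set (S × S)) (t : ℕ → S) : Prop :=
  t 0 ∈ S0 ∧ ∀ i, (t i, t (i + 1)) ∈ ρ

/-- `ξ` is a valid observation on `t` if `t i ∈ ξ` for infinitely many `i`. -/
def ValidObs {S : Type*} (ξ : Set S) (t : ℕ → S) : Prop :=
  {i : ℕ | t i ∈ ξ}.Infinite

/-- The filtered trace `t|ξ`. -/
noncomputable def filterTrace {S : Type*} (t : ℕ → S) (ξ : Set S) : ℕ → S :=
  fun i => t (Nat.nth (fun j => t j ∈ ξ) i)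

/-- Initial states of the observation-projection system `T_O`: all `s ∈ O` reachable
from an initial state by a path (of length `n ≥ 0`) all of whose states before the
endpoint lie outside `O`. -/
def projInit {C : Type*} (S0 : Set C) (ρ : Set (C × C)) (O : Set C) : Set C :=
  {s | s ∈ O ∧ ∃ n : ℕ, ∃ pth : ℕ → C, pth 0 ∈ S0 ∧ pth n = s ∧
    (∀ i < n, (pth i, pth (i + 1)) ∈ ρ) ∧ (∀ i < n, pth i ∉ O)}

/-- Transition relation of the observation-projection system `T_O`: all pairs
`(s, s') ∈ O × O` connected by a `ρ`-path of length `n ≥ 1` whose strictly inner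
states lie outside `O`. -/
def projStep {C : Type*} (ρ : Set (C × C)) (O : Set C) : Set (C × C) :=
  {e | e.1 ∈ O ∧ e.2 ∈ O ∧ ∃ n : ℕ, 1 ≤ n ∧ ∃ pth : ℕ → C, pth 0 = e.1 ∧ pth n = e.2 ∧
    (∀ i < n, (pth i, pth (i + 1)) ∈ ρ) ∧ (∀ i, 1 ≤ i → i < n → pth i ∉ O)}

theorem nth_eq_of_strictMono {p : ℕ → Prop} {pos : ℕ → ℕ} (hpos : StrictMono pos)
    (h : ∀ m, p m ↔ m ∈ Set.range pos) : Nat.nth p = pos := by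
  have hs : Set.ofPred p = Set.range pos := Set.ext h
  have hinf : (Set.ofPred p).Infinite := hs ▸ Set.infinite_range_of_injective hpos.injective
  rw [← StrictMono.range_inj (Nat.nth_strictMono hinf) hpos, Nat.range_nth_of_infinite hinf, hs]

theorem StrictMono.exists_le_and_lt_succ {pos : ℕ → ℕ} (hpos : StrictMono pos) {m : ℕ}
    (hm : pos 0 ≤ m) : ∃ k, pos k ≤ m ∧ m < pos (k + 1) := by
  have hex : ∃ k, m < pos k := ⟨m + 1, (Nat.lt_succ_self m).trans_le (hpos.le_apply)⟩
  classical
  obtain ⟨k, hk⟩ : ∃ k, Nat.find hex = k + 1 := by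
    refine Nat.exists_eq_succ_of_ne_zero fun h0 => ?_
    have := Nat.find_spec hex
    rw [h0] at this
    omega
  refine ⟨k, ?_, hk ▸ Nat.find_spec hex⟩
  exact not_lt.1 (Nat.find_min hex (by omega))

/-- An initial path of length `n₀` and paths `p k` of positive lengths `len k`, each starting
where the previous one ends, glue to a single sequence. -/
theorem exists_glue_paths {C : Type*} {n₀ : ℕ} {p₀ : ℕ → C} {len : ℕ → ℕ} {p : ℕ → ℕ → C}
    (hlen : ∀ k, 1 ≤ len k) (h₀ : p₀ n₀ = p 0 0) (hp : ∀ k, p k (len k) = p (k + 1) 0) :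
    ∃ (pos : ℕ → ℕ) (t : ℕ → C), StrictMono pos ∧ pos 0 = n₀ ∧
      (∀ k, pos (k + 1) = pos k + len k) ∧ (∀ m ≤ n₀, t m = p₀ m) ∧
      ∀ k, ∀ j ≤ len k, t (pos k + j) = p k j := by
  classical
  let pos : ℕ → ℕ := fun k => n₀ + ∑ i ∈ Finset.range k, len i
  have hsucc : ∀ k, pos (k + 1) = pos k + len k := fun k => by
    simp only [pos, Finset.sum_range_succ, add_assoc]
  have hzero : pos 0 = n₀ := by simp [pos]
  have hmono : StrictMono pos := strictMono_nat_of_lt_succ fun k => by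
    have := hlen k
    have := hsucc k
    omega
  have hK : ∀ m, ∃ k, pos 0 ≤ m → pos k ≤ m ∧ m < pos (k + 1) := fun m => by
    by_cases hm : pos 0 ≤ m
    · obtain ⟨k, hk⟩ := hmono.exists_le_and_lt_succ hm
      exact ⟨k, fun _ => hk⟩
    · exact ⟨0, fun h => absurd h hm⟩
  choose K hK using hK
  let t : ℕ → C := fun m => if m < n₀ then p₀ m else p (K m) (m - pos (K m))
  have ht : ∀ k, ∀ j < len k, t (pos k + j) = p k j := fun k j hj => by
    have hle : pos 0 ≤ pos k := hmono.monotone (Nat.zero_le k)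
    obtain ⟨h₁, h₂⟩ := hK (pos k + j) (by omega)
    have hk : K (pos k + j) = k := by
      have h₃ : K (pos k + j) < k + 1 := hmono.lt_iff_lt.1 (by have := hsucc k; omega)
      have h₄ : k < K (pos k + j) + 1 := hmono.lt_iff_lt.1 (by omega)
      omega
    simp only [t]
    rw [if_neg (by omega), hk, Nat.add_sub_cancel_left]
  refine ⟨pos, t, hmono, hzero, hsucc, fun m hm => ?_, fun k j hj => ?_⟩
  · rcases hm.lt_or_eq with h | rfl
    · exact if_pos h
    · rw [h₀, ← ht 0 0 (hlen 0), hzero, add_zero]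
  · rcases hj.lt_or_eq with h | rfl
    · exact ht k j h
    · rw [← hsucc, hp, ← ht (k + 1) 0 (hlen _), add_zero]

theorem exists_trace_of_isTrace_proj {C : Type*} {S0 : Set C} {ρ : Set (C × C)} {O : Set C}
    {u : ℕ → C} (hu : IsTrace (projInit S0 ρ O) (projStep ρ O) u) :
    ∃ t : ℕ → C, IsTrace S0 ρ t ∧ ValidObs O t ∧ u = filterTrace t O := by
  obtain ⟨⟨hu0, n₀, p₀, hinit, hend, hstep₀, hout₀⟩, hu⟩ := hu
  have huO : ∀ k, u k ∈ O := fun k => (hu k).1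
  choose len hlen p hpstart hpend hpstep hpout using fun k => (hu k).2.2
  simp only at hpstart hpend
  obtain ⟨pos, t, hmono, hzero, hsucc, ht₀, ht⟩ := exists_glue_paths (p₀ := p₀) (n₀ := n₀) (p := p) hlen
    (by rw [hend, hpstart]) (fun k => by rw [hpend, hpstart])
  have htpos : ∀ k, t (pos k) = u k := fun k => by
    rw [← hpstart k, ← ht k 0 (Nat.zero_le _), add_zero]
  have hsplit : ∀ m, m < n₀ ∨ ∃ k j, j < len k ∧ m = pos k + j := fun m => by
    rcases lt_or_ge m n₀ with h | h
    · exact Or.inl h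
    · obtain ⟨k, h₁, h₂⟩ := hmono.exists_le_and_lt_succ (hzero.trans_le h)
      have := hsucc k
      exact Or.inr ⟨k, m - pos k, by omega, by omega⟩
  have hO : ∀ m, t m ∈ O ↔ m ∈ Set.range pos := fun m => by
    constructor
    · intro hm
      rcases hsplit m with h | ⟨k, j, hj, rfl⟩
      · exact absurd (ht₀ m h.le ▸ hm) (hout₀ m h)
      · rcases Nat.eq_zero_or_pos j with rfl | hj0
        · exact ⟨k, rfl⟩
        · exact absurd (ht k j hj.le ▸ hm) (hpout k j hj0 hj)
    · rintro ⟨k, rfl⟩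
      exact htpos k ▸ huO k
  refine ⟨t, ⟨?_, fun m => ?_⟩, ?_, ?_⟩
  · rw [ht₀ 0 (Nat.zero_le _)]
    exact hinit
  · rcases hsplit m with h | ⟨k, j, hj, rfl⟩
    · rw [ht₀ m h.le, ht₀ (m + 1) h]
      exact hstep₀ m h
    · rw [add_assoc, ht k j hj.le, ht k (j + 1) hj]
      exact hpstep k j hj
  · have hs : {i | t i ∈ O} = Set.range pos := Set.ext hO
    rw [ValidObs, hs]
    exact Set.infinite_range_of_injective hmono.injective
  · funext k
    rw [filterTrace, nth_eq_of_strictMono hmono hO, htpos]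

theorem isTrace_proj_filterTrace {C : Type*} {S0 : Set C} {ρ : Set (C × C)} {O : Set C}
    {t : ℕ → C} (ht : IsTrace S0 ρ t) (hv : ValidObs O t) :
    IsTrace (projInit S0 ρ O) (projStep ρ O) (filterTrace t O) := by
  have hmono : StrictMono (Nat.nth fun j => t j ∈ O) := Nat.nth_strictMono hv
  have hmem : ∀ k, t (Nat.nth (fun j => t j ∈ O) k) ∈ O := Nat.nth_mem_of_infinite hv
  have hrange : ∀ m, t m ∈ O → ∃ k, Nat.nth (fun j => t j ∈ O) k = m := fun m hm =>
    (Nat.range_nth_of_infinite hv).ge hm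
  refine ⟨⟨hmem 0, _, t, ht.1, rfl, fun i _ => ht.2 i, fun i hi hiO => ?_⟩, fun k =>
    ⟨hmem k, hmem (k + 1), Nat.nth (fun j => t j ∈ O) (k + 1) - Nat.nth (fun j => t j ∈ O) k, ?_,
      fun i => t (Nat.nth (fun j => t j ∈ O) k + i), rfl, ?_, fun i _ => ht.2 _,
      fun i h₁ h₂ hiO => ?_⟩⟩
  · obtain ⟨k, rfl⟩ := hrange i hiO
    exact absurd (hmono.lt_iff_lt.1 hi) (Nat.not_lt_zero k)
  · have := hmono (Nat.lt_add_one k)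
    omega
  · have := hmono (Nat.lt_add_one k)
    simp only [filterTrace]
    congr 1
    omega
  · obtain ⟨l, hl⟩ := hrange _ hiO
    have h₃ : k < l := hmono.lt_iff_lt.1 (by omega)
    have h₄ : l < k + 1 := hmono.lt_iff_lt.1 (by omega)
    omega

/-- the traces of the observation-projection system `T_O` are exactly the
`O`-filtered traces of `T` on which `O` is a valid observation. -/
theorem projection_system_traces {C : Type*} (S0 : Set C) (ρ : Set (C × C)) (O : Set C) :
    {u : ℕ → C | IsTrace (projInit S0 ρ O) (projStep ρ O) u} =
      {u : ℕ → C | ∃ t : ℕ → C, IsTrace S0 ρ t ∧ ValidObs O t ∧ u = filterTrace t O} := by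
  ext u
  constructor
  · exact exists_trace_of_isTrace_proj
  · rintro ⟨t, ht, hv, rfl⟩
    exact isTrace_proj_filterTrace ht hv
end

section
/- Stuttering preserves filtered traces (observation alignment, used in the proof of Theorem 2): Let t : ℕ → S be a trace and ξ ⊆ S an observation set that is a valid observation on t. Let f : ℕ → ℕ be monotone nondecreasing and surjective, and suppose that for every index i with t(i) ∈ ξ, the preimage f⁻¹({i}) is a singleton. Then ξ is a valid observation on the stuttered trace t ∘ f, and (t ∘ f)|ξ = t|ξ. -/
/-- A monotone surjection that is injective over `p` carries the increasing enumeration of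
`p ∘ f` to the increasing enumeration of `p`. -/
theorem nth_comp_eq_of_monotone_of_surjective {p : ℕ → Prop} {f : ℕ → ℕ}
    (hp : {i | p i}.Infinite) (hpf : {i | p (f i)}.Infinite) (hmono : Monotone f)
    (hsurj : Function.Surjective f) (hinj : ∀ a b, p (f a) → f a = f b → a = b) :
    f ∘ Nat.nth (fun j => p (f j)) = Nat.nth p := by
  have hstrict : StrictMono (f ∘ Nat.nth (fun j => p (f j))) := fun a b hab =>
    (hmono (Nat.nth_strictMono hpf hab).le).lt_of_ne fun h =>
      (Nat.nth_strictMono hpf hab).ne (hinj _ _ (Nat.nth_mem_of_infinite hpf a) h)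
  refine (hstrict.range_inj (Nat.nth_strictMono hp)).1 ?_
  rw [Set.range_comp, Nat.range_nth_of_infinite hpf, Nat.range_nth_of_infinite hp]
  exact Set.image_preimage_eq {i | p i} hsurj

/-- stuttering preserves filtered traces. If `f : ℕ → ℕ` is monotone
nondecreasing and surjective, and every observed index of `t` has a singleton
`f`-preimage, then `ξ` is a valid observation on the stuttered trace `t ∘ f` and
`(t ∘ f)|ξ = t|ξ`. -/
theorem stutter_preserves_filterTrace {S : Type*} (t : ℕ → S) (ξ : Set S)
    (hv : ValidObs ξ t) (f : ℕ → ℕ) (hmono : Monotone f)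
    (hsurj : Function.Surjective f)
    (hsing : ∀ i : ℕ, t i ∈ ξ → ∃ j : ℕ, f ⁻¹' {i} = {j}) :
    ValidObs ξ (t ∘ f) ∧ filterTrace (t ∘ f) ξ = filterTrace t ξ := by
  have hinf : ValidObs ξ (t ∘ f) := hv.preimage (by simp [hsurj.range_eq])
  refine ⟨hinf, funext fun i => congrArg t ?_⟩
  refine congrFun (nth_comp_eq_of_monotone_of_surjective hv hinf hmono hsurj ?_) i
  intro a b ha hab
  obtain ⟨j, hj⟩ := hsing (f a) ha
  have haj : a ∈ f ⁻¹' {f a} := rfl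
  have hbj : b ∈ f ⁻¹' {f a} := hab.symm
  rw [hj] at haj hbj
  exact haj.trans hbj.symm
end
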